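/- Soundness of type inference: if the type inference algorithm succeeds with T(M) = (Γ, σ), then Γ ⊢₂ M : σ is derivable in the Linear Rank 2 Intersection Type System. -/

import Mathlib

/-! ## λ-terms -/

inductive Term : Type
  | var : ℕ → Term
  | lam : ℕ → Term → Term
  | app : Term → Term → Term

namespace Term

/-- free variables -/
def fv : Term → Finset ℕ
  | .var x => {x}
  | .lam x M => fv M \ {x}
  | .app M N => fv M ∪ fv N

/-- all variables occurring in a term (free, bound or binding) -/
def allVars : Term → Finset ℕ
  | .var x => {x}
  | .lam x M => insert x (allVars M)
  | .app M N => allVars M ∪ allVars N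

/-- substitution `M[N/x]` (as in the paper, under the variable convention) -/
def subst : Term → ℕ → Term → Term
  | .var y, x, N => if y = x then N else .var y
  | .lam y M, x, N => if y = x then .lam y M else .lam y (subst M x N)
  | .app M₁ M₂, x, N => .app (subst M₁ x N) (subst M₂ x N)

/-- simultaneous renaming `M[y₁/x₁, …, yₙ/xₙ]` (the `yᵢ` being fresh) -/
def renList (M : Term) (xs ys : List ℕ) : Term :=
  (xs.zip ys).foldl (fun N q => N.subst q.1 (.var q.2)) M

/-- `M` is an abstraction -/
def IsAbs (M : Term) : Prop := ∃ x N, M = lam x N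

end Term

/-! ## Linear types and linear rank 2 intersection types -/

/-- linear types (linear rank 0 intersection types) -/
inductive LTy : Type
  | var : ℕ → LTy
  | lolly : LTy → LTy → LTy

/-- type variables of a linear type -/
def LTy.tv : LTy → Finset ℕ
  | .var α => {α}
  | .lolly a b => a.tv ∪ b.tv

/-- linear rank 2 intersection types: `σ ::= τ | τ ⊸ σ | (τ₁ ∩ ⋯ ∩ τₙ) → σ`.
Sequences (linear rank 1 types) are multisets of linear types (`∩` is associative,
commutative and non-idempotent); the constraint `n ≥ 2` on `arrow` is enforced in
the typing rules. -/
inductive Ty2 : Type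
  | lin : LTy → Ty2
  | lolly : LTy → Ty2 → Ty2
  | arrow : Multiset LTy → Ty2 → Ty2

/-- `τ ⊸ σ`: identifies `τ ⊸ τ'` (for `τ'` linear) with the linear type `τ ⊸ τ'`,
so that every rank 2 type has a unique representation. -/
def Ty2.mkLolly (τ : LTy) : Ty2 → Ty2
  | .lin τ' => .lin (.lolly τ τ')
  | σ => .lolly τ σ

/-- type variables of a rank 2 type -/
def Ty2.tv : Ty2 → Finset ℕ
  | .lin τ => τ.tv
  | .lolly τ σ => τ.tv ∪ σ.tv
  | .arrow A σ => (A.map LTy.tv).sup ∪ σ.tv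

/-- type substitutions (mapping type variables to linear types) -/
abbrev TSub := ℕ → LTy

def LTy.applyS (S : TSub) : LTy → LTy
  | .var α => S α
  | .lolly a b => .lolly (a.applyS S) (b.applyS S)

def Ty2.applyS (S : TSub) : Ty2 → Ty2
  | .lin τ => .lin (τ.applyS S)
  | .lolly τ σ => .lolly (τ.applyS S) (σ.applyS S)
  | .arrow A σ => .arrow (A.map (LTy.applyS S)) (σ.applyS S)

/-! ## Environments -/

section GEnv
variable {β : Type}

/-- the domain of an environment -/
def domG (Γ : List (ℕ × β)) : List ℕ := Γ.map Prod.fst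

/-- a finite list of declarations is consistent iff the term variables are distinct -/
def consistentG (Γ : List (ℕ × β)) : Prop := (Γ.map Prod.fst).Nodup

/-- the predicate declared for `x` (defaulting to `0`, i.e. empty) -/
def lookupG [Zero β] (Γ : List (ℕ × β)) (x : ℕ) : β :=
  ((Γ.find? (fun p => p.1 == x)).map Prod.snd).getD 0

/-- `Γ₁ + Γ₂`: merge two environments, intersecting the predicates of common
variables; declarations of `Γ₁` come first, in order, followed by the
declarations of variables only in `Γ₂`, in order. -/
def addG [Zero β] [Add β] (Γ₁ Γ₂ : List (ℕ × β)) : List (ℕ × β) :=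
  Γ₁.map (fun p => (p.1, p.2 + lookupG Γ₂ p.1)) ++
    Γ₂.filter (fun p => !((Γ₁.map Prod.fst).contains p.1))

/-- `Σᵢ Γᵢ` -/
def sumG [Zero β] [Add β] (l : List (List (ℕ × β))) : List (ℕ × β) :=
  l.foldr addG []

/-- `Γ_x` : remove the declaration of `x` from `Γ` -/
def eraseG (Γ : List (ℕ × β)) (x : ℕ) : List (ℕ × β) :=
  Γ.filter (fun p => !(p.1 == x))

/-- `Γ[y/x]` : rename the declared variable `x` to `y` -/
def renG (Γ : List (ℕ × β)) (x y : ℕ) : List (ℕ × β) :=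
  Γ.map (fun p => (if p.1 = x then y else p.1, p.2))

/-- `Γ[y₁/x₁, …, yₙ/xₙ]` -/
def renListG (Γ : List (ℕ × β)) (xs ys : List ℕ) : List (ℕ × β) :=
  (xs.zip ys).foldl (fun Δ q => renG Δ q.1 q.2) Γ

end GEnv

/-- environments of the Linear Rank 2 Intersection Type System
(also called `T¹_L`-environments) -/
abbrev Env := List (ℕ × Multiset LTy)

/-- applying a type substitution to an environment -/
def envApplyS (S : TSub) (Γ : Env) : Env :=
  Γ.map (fun p => (p.1, p.2.map (LTy.applyS S)))

/-- the type variables occurring in an environment -/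
def envTv (Γ : Env) : Finset ℕ :=
  Γ.foldr (fun p acc => (p.2.map LTy.tv).sup ∪ acc) ∅

/-- the type variables occurring in a pair (environment, type) -/
def tvOf (Γ : Env) (σ : Ty2) : Finset ℕ := envTv Γ ∪ σ.tv

/-! ## The Linear Rank 2 Intersection Type System (with depth-indexed derivations) -/

/-- `DerN d Γ M σ`: there is a derivation of depth `d` of `Γ ⊢₂ M : σ`. -/
inductive DerN : ℕ → Env → Term → Ty2 → Prop
  | ax (x : ℕ) (τ : LTy) :
      DerN 0 [(x, {τ})] (.var x) (.lin τ)
  | exch (d : ℕ) (Γ₁ Γ₂ : Env) (x y : ℕ) (A B : Multiset LTy) (M : Term) (σ : Ty2) :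
      DerN d (Γ₁ ++ (x, A) :: (y, B) :: Γ₂) M σ →
      DerN (d + 1) (Γ₁ ++ (y, B) :: (x, A) :: Γ₂) M σ
  | contr (d : ℕ) (Γ₁ Γ₂ : Env) (x₁ x₂ x : ℕ) (A B : Multiset LTy) (M : Term) (σ : Ty2) :
      DerN d (Γ₁ ++ (x₁, A) :: (x₂, B) :: Γ₂) M σ →
      x ∉ domG (Γ₁ ++ Γ₂) →
      DerN (d + 1) (Γ₁ ++ (x, A + B) :: Γ₂) ((M.subst x₁ (.var x)).subst x₂ (.var x)) σ
  | introArrow (d : ℕ) (Γ : Env) (x : ℕ) (A : Multiset LTy) (M : Term) (σ : Ty2) :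
      DerN d (Γ ++ [(x, A)]) M σ →
      2 ≤ Multiset.card A →
      DerN (d + 1) Γ (.lam x M) (.arrow A σ)
  | introLolly (d : ℕ) (Γ : Env) (x : ℕ) (τ : LTy) (M : Term) (σ : Ty2) :
      DerN d (Γ ++ [(x, ({τ} : Multiset LTy))]) M σ →
      DerN (d + 1) Γ (.lam x M) (Ty2.mkLolly τ σ)
  | elimLolly (d₁ d₂ : ℕ) (Γ₁ Γ₂ : Env) (M₁ M₂ : Term) (τ : LTy) (σ : Ty2) :
      DerN d₁ Γ₁ M₁ (Ty2.mkLolly τ σ) →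
      DerN d₂ Γ₂ M₂ (.lin τ) →
      consistentG (Γ₁ ++ Γ₂) →
      DerN (max d₁ d₂ + 1) (Γ₁ ++ Γ₂) (.app M₁ M₂) σ
  | elimArrow (d : ℕ) (Γ : Env) (M₁ M₂ : Term) (σ : Ty2) (l : List (ℕ × Env × LTy)) :
      DerN d Γ M₁ (.arrow (Multiset.ofList (l.map (fun p => p.2.2))) σ) →
      (∀ p ∈ l, DerN p.1 p.2.1 M₂ (.lin p.2.2)) →
      2 ≤ l.length →
      consistentG (Γ ++ sumG (l.map (fun p => p.2.1))) →
      DerN (max d ((l.map Prod.fst).foldr max 0) + 1)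
        (Γ ++ sumG (l.map (fun p => p.2.1))) (.app M₁ M₂) σ

/-- `Γ ⊢₂ M : σ` in the Linear Rank 2 Intersection Type System. -/
def Der (Γ : Env) (M : Term) (σ : Ty2) : Prop := ∃ d, DerN d Γ M σ

/-! ## Unification and the type inference algorithm -/

/-- `S` unifies all the equations of `P` -/
def Unifies (S : TSub) (P : List (LTy × LTy)) : Prop :=
  ∀ e ∈ P, LTy.applyS S e.1 = LTy.applyS S e.2

/-- `S` is a most general unifier of `P` -/
def IsMGU (S : TSub) (P : List (LTy × LTy)) : Prop :=
  Unifies S P ∧ ∀ S' : TSub, Unifies S' P →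
    ∃ S'' : TSub, ∀ α, S' α = LTy.applyS S'' (S α)

/-- `Infer M Γ σ` : the type inference algorithm, run on `M`, may return `(Γ, σ)`
(fresh type variables are modelled by disjointness side conditions). -/
inductive Infer : Term → Env → Ty2 → Prop
  | var (x α : ℕ) :
      Infer (.var x) [(x, {LTy.var α})] (.lin (.var α))
  | lamLolly {M₁ : Term} {Γ₁ : Env} {σ₁ : Ty2} (x : ℕ) (τ : LTy) :
      Infer M₁ Γ₁ σ₁ →
      (x, ({τ} : Multiset LTy)) ∈ Γ₁ →
      Infer (.lam x M₁) (eraseG Γ₁ x) (Ty2.mkLolly τ σ₁)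
  | lamArrow {M₁ : Term} {Γ₁ : Env} {σ₁ : Ty2} (x : ℕ) (A : Multiset LTy) :
      Infer M₁ Γ₁ σ₁ →
      (x, A) ∈ Γ₁ →
      2 ≤ Multiset.card A →
      Infer (.lam x M₁) (eraseG Γ₁ x) (.arrow A σ₁)
  | appVar {M₁ M₂ : Term} {Γ₁ Γ₂ : Env} (α₁ : ℕ) (τ₂ : LTy) (α₂ α₃ : ℕ) (S : TSub) :
      Infer M₁ Γ₁ (.lin (.var α₁)) →
      Infer M₂ Γ₂ (.lin τ₂) →
      Disjoint (tvOf Γ₁ (.lin (.var α₁))) (tvOf Γ₂ (.lin τ₂)) →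
      α₂ ∉ tvOf Γ₁ (.lin (.var α₁)) ∪ tvOf Γ₂ (.lin τ₂) →
      α₃ ∉ tvOf Γ₁ (.lin (.var α₁)) ∪ tvOf Γ₂ (.lin τ₂) →
      α₂ ≠ α₃ →
      IsMGU S [(LTy.var α₁, LTy.lolly (.var α₂) (.var α₃)), (τ₂, LTy.var α₂)] →
      Infer (.app M₁ M₂) (envApplyS S (addG Γ₁ Γ₂)) (.lin (S α₃))
  | appArrow {M₁ M₂ : Term} {Γ₁ : Env} {σ₁ : Ty2}
      (l : List (Env × LTy)) (ts : List LTy) (S : TSub) :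
      Infer M₁ Γ₁ (.arrow (Multiset.ofList ts) σ₁) →
      (∀ p ∈ l, Infer M₂ p.1 (.lin p.2)) →
      l.length = ts.length →
      2 ≤ l.length →
      List.Pairwise (fun p q => Disjoint (tvOf p.1 (.lin p.2)) (tvOf q.1 (.lin q.2))) l →
      (∀ p ∈ l, Disjoint (tvOf Γ₁ (.arrow (Multiset.ofList ts) σ₁)) (tvOf p.1 (.lin p.2))) →
      IsMGU S ((l.map Prod.snd).zip ts) →
      Infer (.app M₁ M₂) (envApplyS S (addG Γ₁ (sumG (l.map Prod.fst)))) (Ty2.applyS S σ₁)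
  | appLolly {M₁ M₂ : Term} {Γ₁ Γ₂ : Env} (τ : LTy) (σ₁ : Ty2) (τ₂ : LTy) (S : TSub) :
      Infer M₁ Γ₁ (Ty2.mkLolly τ σ₁) →
      Infer M₂ Γ₂ (.lin τ₂) →
      Disjoint (tvOf Γ₁ (Ty2.mkLolly τ σ₁)) (tvOf Γ₂ (.lin τ₂)) →
      IsMGU S [(τ₂, τ)] →
      Infer (.app M₁ M₂) (envApplyS S (addG Γ₁ Γ₂)) (Ty2.applyS S σ₁)

/-! ## Multi-types and the Linear Rank 2 Quantitative Type System -/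

/-- rank 0 multi-types: `t ::= Neutral | Abs | α | t ⊸ t` -/
inductive MTy : Type
  | Neutral : MTy
  | Abs : MTy
  | var : ℕ → MTy
  | lolly : MTy → MTy → MTy

/-- rank 2 multi-types (rank 1 multi-types are multisets of rank 0 multi-types) -/
inductive MTy2 : Type
  | base : MTy → MTy2
  | lolly : MTy → MTy2 → MTy2
  | arrow : Multiset MTy → MTy2 → MTy2

/-- `t ⊸ s`, identifying `t ⊸ t'` with the rank 0 multi-type `t ⊸ t'` -/
def MTy2.mkLolly (t : MTy) : MTy2 → MTy2
  | .base t' => .base (.lolly t t')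
  | s => .lolly t s

/-- a rank 0 multi-type is tight iff it is one of the tight constants -/
def MTy.tight (t : MTy) : Prop := t = .Neutral ∨ t = .Abs

/-- a rank 1 multi-type is tight iff all its components are -/
def tightSeq (ts : Multiset MTy) : Prop := ∀ t ∈ ts, MTy.tight t

/-- a rank 2 multi-type is tight iff it is a tight constant -/
def MTy2.tight (s : MTy2) : Prop := s = .base .Neutral ∨ s = .base .Abs

/-- environments of the quantitative system: each declaration carries a pair
(sequence of linear types, rank 1 multi-type) -/
abbrev QEnv := List (ℕ × (Multiset LTy × Multiset MTy))

/-- a quantitative environment is tight iff all its multi-type components are -/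
def tightE (Γ : QEnv) : Prop := ∀ p ∈ Γ, tightSeq p.2.2

/-- the Linear Rank 2 Quantitative Type System: `QDer Γ b M σ s` is
`Γ ⊢^b M : σ | s`. -/
inductive QDer : QEnv → ℕ → Term → Ty2 → MTy2 → Prop
  | ax (x : ℕ) (τ : LTy) (t : MTy) :
      QDer [(x, ({τ}, {t}))] 0 (.var x) (.lin τ) (.base t)
  | exch (Γ₁ Γ₂ : QEnv) (x y : ℕ) (A B : Multiset LTy × Multiset MTy)
      (b : ℕ) (M : Term) (σ : Ty2) (s : MTy2) :
      QDer (Γ₁ ++ (x, A) :: (y, B) :: Γ₂) b M σ s →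
      QDer (Γ₁ ++ (y, B) :: (x, A) :: Γ₂) b M σ s
  | contr (Γ₁ Γ₂ : QEnv) (x₁ x₂ x : ℕ) (A₁ A₂ : Multiset LTy × Multiset MTy)
      (b : ℕ) (M : Term) (σ : Ty2) (s : MTy2) :
      QDer (Γ₁ ++ (x₁, A₁) :: (x₂, A₂) :: Γ₂) b M σ s →
      x ∉ domG (Γ₁ ++ Γ₂) →
      QDer (Γ₁ ++ (x, A₁ + A₂) :: Γ₂) b ((M.subst x₁ (.var x)).subst x₂ (.var x)) σ s
  | introLolly (Γ : QEnv) (x : ℕ) (τ : LTy) (t : MTy) (b : ℕ) (M : Term) (σ : Ty2) (s : MTy2) :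
      QDer (Γ ++ [(x, ({τ}, {t}))]) b M σ s →
      QDer Γ (b + 1) (.lam x M) (Ty2.mkLolly τ σ) (MTy2.mkLolly t s)
  | introLollyT (Γ : QEnv) (x : ℕ) (τ : LTy) (t : MTy) (b : ℕ) (M : Term) (σ : Ty2) (s : MTy2) :
      QDer (Γ ++ [(x, ({τ}, {t}))]) b M σ s →
      MTy.tight t →
      MTy2.tight s →
      QDer Γ b (.lam x M) (Ty2.mkLolly τ σ) (.base .Abs)
  | introArrow (Γ : QEnv) (x : ℕ) (A : Multiset LTy) (ts : Multiset MTy)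
      (b : ℕ) (M : Term) (σ : Ty2) (s : MTy2) :
      QDer (Γ ++ [(x, (A, ts))]) b M σ s →
      2 ≤ Multiset.card A →
      Multiset.card ts = Multiset.card A →
      QDer Γ (b + 1) (.lam x M) (.arrow A σ) (.arrow ts s)
  | introArrowT (Γ : QEnv) (x : ℕ) (A : Multiset LTy) (ts : Multiset MTy)
      (b : ℕ) (M : Term) (σ : Ty2) (s : MTy2) :
      QDer (Γ ++ [(x, (A, ts))]) b M σ s →
      2 ≤ Multiset.card A →
      tightSeq ts →
      MTy2.tight s →
      QDer Γ b (.lam x M) (.arrow A σ) (.base .Abs)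
  | elimLolly (Γ₁ Γ₂ : QEnv) (b₁ b₂ : ℕ) (M₁ M₂ : Term) (τ : LTy) (σ : Ty2) (t : MTy) (s : MTy2) :
      QDer Γ₁ b₁ M₁ (Ty2.mkLolly τ σ) (MTy2.mkLolly t s) →
      QDer Γ₂ b₂ M₂ (.lin τ) (.base t) →
      consistentG (Γ₁ ++ Γ₂) →
      QDer (Γ₁ ++ Γ₂) (b₁ + b₂) (.app M₁ M₂) σ s
  | elimLollyT (Γ₁ Γ₂ : QEnv) (b₁ b₂ : ℕ) (M₁ M₂ : Term) (τ : LTy) (σ : Ty2) (s₂ : MTy2) :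
      QDer Γ₁ b₁ M₁ (Ty2.mkLolly τ σ) (.base .Neutral) →
      QDer Γ₂ b₂ M₂ (.lin τ) s₂ →
      MTy2.tight s₂ →
      consistentG (Γ₁ ++ Γ₂) →
      QDer (Γ₁ ++ Γ₂) (b₁ + b₂) (.app M₁ M₂) σ (.base .Neutral)
  | elimArrow (Γ : QEnv) (b : ℕ) (M₁ M₂ : Term) (σ : Ty2) (s : MTy2)
      (l : List (QEnv × ℕ × LTy × MTy)) :
      QDer Γ b M₁ (.arrow (Multiset.ofList (l.map (fun p => p.2.2.1))) σ)
        (.arrow (Multiset.ofList (l.map (fun p => p.2.2.2))) s) →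
      (∀ p ∈ l, QDer p.1 p.2.1 M₂ (.lin p.2.2.1) (.base p.2.2.2)) →
      2 ≤ l.length →
      consistentG (Γ ++ sumG (l.map Prod.fst)) →
      QDer (Γ ++ sumG (l.map Prod.fst)) (b + (l.map (fun p => p.2.1)).sum) (.app M₁ M₂) σ s
  | elimArrowT (Γ : QEnv) (b : ℕ) (M₁ M₂ : Term) (σ : Ty2)
      (l : List (QEnv × ℕ × LTy × MTy2)) :
      QDer Γ b M₁ (.arrow (Multiset.ofList (l.map (fun p => p.2.2.1))) σ) (.base .Neutral) →
      (∀ p ∈ l, QDer p.1 p.2.1 M₂ (.lin p.2.2.1) p.2.2.2) →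
      (∀ p ∈ l, MTy2.tight p.2.2.2) →
      2 ≤ l.length →
      consistentG (Γ ++ sumG (l.map Prod.fst)) →
      QDer (Γ ++ sumG (l.map Prod.fst)) (b + (l.map (fun p => p.2.1)).sum)
        (.app M₁ M₂) σ (.base .Neutral)

/-! ## Leftmost-outermost normal forms and evaluation -/

namespace Term

mutual
  /-- leftmost-outermost neutral terms -/
  inductive Neutral : Term → Prop
    | var (x : ℕ) : Neutral (.var x)
    | app {M N : Term} : Neutral M → Normal N → Neutral (.app M N)
  /-- leftmost-outermost normal terms -/
  inductive Normal : Term → Prop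
    | of_neutral {M : Term} : Neutral M → Normal M
    | lam (x : ℕ) {M : Term} : Normal M → Normal (.lam x M)
end

/-- one step of the leftmost-outermost evaluation strategy -/
inductive Step : Term → Term → Prop
  | beta (x : ℕ) (M N : Term) : Step (.app (.lam x M) N) (M.subst x N)
  | lam (x : ℕ) {M M' : Term} : Step M M' → Step (.lam x M) (.lam x M')
  | appL {M M' N : Term} : Step M M' → ¬ IsAbs M → Step (.app M N) (.app M' N)
  | appR {N M M' : Term} : Neutral N → Step M M' → Step (.app N M) (.app N M')

/-- `StepsN b M N` : `M ⟶^b N`, i.e. `M` reduces to `N` in exactly `b`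
leftmost-outermost steps -/
inductive StepsN : ℕ → Term → Term → Prop
  | refl (M : Term) : StepsN 0 M M
  | step {M M' N : Term} {b : ℕ} : Step M M' → StepsN b M' N → StepsN (b + 1) M N

end Term

/-! ## Quantitative unification and the quantitative type inference algorithm -/

/-- `[τ/α]` applied to a linear type -/
def substVar (τ : LTy) (α : ℕ) : LTy → LTy
  | .var β => if β = α then τ else .var β
  | .lolly a b => .lolly (substVar τ α a) (substVar τ α b)

/-- `[τ/α]` applied to a unification problem -/
def substEqs (τ : LTy) (α : ℕ) (P : Multiset (LTy × LTy)) : Multiset (LTy × LTy) :=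
  P.map (fun e => (substVar τ α e.1, substVar τ α e.2))

/-- `α` occurs in the unification problem `P` -/
def occursIn (α : ℕ) (P : Multiset (LTy × LTy)) : Prop :=
  ∃ e ∈ P, α ∈ e.1.tv ∨ α ∈ e.2.tv

/-- one transformation step `P ⇒ P'` on unification problems; the third component
is `1` for a decomposition step `{τ₁ ⊸ τ₂ = τ₃ ⊸ τ₄} ∪ P ⇒ {τ₁ = τ₃, τ₂ = τ₄} ∪ P`
and `0` otherwise -/
inductive UStep : Multiset (LTy × LTy) → Multiset (LTy × LTy) → ℕ → Prop
  | del (τ : LTy) (P : Multiset (LTy × LTy)) :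
      UStep ((τ, τ) ::ₘ P) P 0
  | dec (a b c d : LTy) (P : Multiset (LTy × LTy)) :
      UStep ((LTy.lolly a b, LTy.lolly c d) ::ₘ P) ((a, c) ::ₘ (b, d) ::ₘ P) 1
  | swap (a b : LTy) (α : ℕ) (P : Multiset (LTy × LTy)) :
      UStep ((LTy.lolly a b, LTy.var α) ::ₘ P) ((LTy.var α, LTy.lolly a b) ::ₘ P) 0
  | elim (α : ℕ) (τ : LTy) (P : Multiset (LTy × LTy)) :
      occursIn α P →
      α ∉ τ.tv →
      UStep ((LTy.var α, τ) ::ₘ P) ((LTy.var α, τ) ::ₘ substEqs τ α P) 0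

/-- iterated transformation steps, accumulating the number of decompositions -/
inductive URun : Multiset (LTy × LTy) → Multiset (LTy × LTy) → ℕ → Prop
  | refl (P : Multiset (LTy × LTy)) : URun P P 0
  | step {P Q R : Multiset (LTy × LTy)} {k b : ℕ} :
      UStep P Q k → URun Q R b → URun P R (k + b)

/-- `P` is in solved form, inducing the substitution `S` -/
def SolvedWith (P : Multiset (LTy × LTy)) (S : TSub) : Prop :=
  ∃ L : List (ℕ × LTy),
    Multiset.ofList (L.map (fun p => (LTy.var p.1, p.2))) = P ∧
    (L.map Prod.fst).Nodup ∧
    (∀ p ∈ L, ∀ q ∈ L, p.1 ∉ q.2.tv) ∧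
    S = fun β => (((L.find? (fun p => p.1 == β)).map Prod.snd).getD (LTy.var β))

/-- `UNIFY_Q(P) = (S, b)`: the quantitative unification algorithm succeeds on `P`
returning the most general unifier `S` and the number `b` of decomposition steps -/
def UnifyQ (P : Multiset (LTy × LTy)) (S : TSub) (b : ℕ) : Prop :=
  ∃ P', URun P P' b ∧ (∀ Q k, ¬ UStep P' Q k) ∧ SolvedWith P' S

/-- `QInfer M Γ σ b` : the quantitative type inference algorithm `T_Q`, run on
`M`, may return `(Γ, σ, b)`. -/
inductive QInfer : Term → Env → Ty2 → ℕ → Prop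
  | var (x α : ℕ) :
      QInfer (.var x) [(x, {LTy.var α})] (.lin (.var α)) 0
  | lamLolly {M₁ : Term} {Γ₁ : Env} {σ₁ : Ty2} {b₁ : ℕ} (x : ℕ) (τ : LTy) :
      QInfer M₁ Γ₁ σ₁ b₁ →
      (x, ({τ} : Multiset LTy)) ∈ Γ₁ →
      QInfer (.lam x M₁) (eraseG Γ₁ x) (Ty2.mkLolly τ σ₁) b₁
  | lamArrow {M₁ : Term} {Γ₁ : Env} {σ₁ : Ty2} {b₁ : ℕ} (x : ℕ) (A : Multiset LTy) :
      QInfer M₁ Γ₁ σ₁ b₁ →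
      (x, A) ∈ Γ₁ →
      2 ≤ Multiset.card A →
      QInfer (.lam x M₁) (eraseG Γ₁ x) (.arrow A σ₁) b₁
  | appVar {M₁ M₂ : Term} {Γ₁ Γ₂ : Env} {b₁ b₂ : ℕ}
      (α₁ : ℕ) (τ₂ : LTy) (α₂ α₃ : ℕ) (S : TSub) (bu : ℕ) :
      QInfer M₁ Γ₁ (.lin (.var α₁)) b₁ →
      QInfer M₂ Γ₂ (.lin τ₂) b₂ →
      Disjoint (tvOf Γ₁ (.lin (.var α₁))) (tvOf Γ₂ (.lin τ₂)) →
      α₂ ∉ tvOf Γ₁ (.lin (.var α₁)) ∪ tvOf Γ₂ (.lin τ₂) →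
      α₃ ∉ tvOf Γ₁ (.lin (.var α₁)) ∪ tvOf Γ₂ (.lin τ₂) →
      α₂ ≠ α₃ →
      UnifyQ {(LTy.var α₁, LTy.lolly (.var α₂) (.var α₃)), (τ₂, LTy.var α₂)} S bu →
      QInfer (.app M₁ M₂) (envApplyS S (addG Γ₁ Γ₂)) (.lin (S α₃)) (b₁ + b₂)
  | appArrow {M₁ M₂ : Term} {Γ₁ : Env} {σ₁ : Ty2} {b₁ : ℕ}
      (l : List (Env × LTy × ℕ)) (ts : List LTy) (S : TSub) (bu : ℕ) :
      QInfer M₁ Γ₁ (.arrow (Multiset.ofList ts) σ₁) b₁ →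
      (∀ p ∈ l, QInfer M₂ p.1 (.lin p.2.1) p.2.2) →
      l.length = ts.length →
      2 ≤ l.length →
      List.Pairwise (fun p q => Disjoint (tvOf p.1 (.lin p.2.1)) (tvOf q.1 (.lin q.2.1))) l →
      (∀ p ∈ l, Disjoint (tvOf Γ₁ (.arrow (Multiset.ofList ts) σ₁)) (tvOf p.1 (.lin p.2.1))) →
      UnifyQ (Multiset.ofList ((l.map (fun p => p.2.1)).zip ts)) S bu →
      QInfer (.app M₁ M₂) (envApplyS S (addG Γ₁ (sumG (l.map Prod.fst)))) (Ty2.applyS S σ₁)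
        (b₁ + (l.map (fun p => p.2.2)).sum + bu + 1)
  | appLolly {M₁ M₂ : Term} {Γ₁ Γ₂ : Env} {b₁ b₂ : ℕ}
      (τ : LTy) (σ₁ : Ty2) (τ₂ : LTy) (S : TSub) (bu : ℕ) :
      QInfer M₁ Γ₁ (Ty2.mkLolly τ σ₁) b₁ →
      QInfer M₂ Γ₂ (.lin τ₂) b₂ →
      Disjoint (tvOf Γ₁ (Ty2.mkLolly τ σ₁)) (tvOf Γ₂ (.lin τ₂)) →
      UnifyQ {(τ₂, τ)} S bu →
      QInfer (.app M₁ M₂) (envApplyS S (addG Γ₁ Γ₂)) (Ty2.applyS S σ₁) (b₁ + b₂ + bu + 1)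

/-! ## Environments: domains, lookup and permutations -/

section GEnvLemmas
variable {β : Type}

theorem domG_append (Γ Δ : List (ℕ × β)) : domG (Γ ++ Δ) = domG Γ ++ domG Δ := by
  simp [domG]

theorem domG_cons (p : ℕ × β) (Γ : List (ℕ × β)) : domG (p :: Γ) = p.1 :: domG Γ := rfl

theorem mem_domG_of_mem {Γ : List (ℕ × β)} {p : ℕ × β} (h : p ∈ Γ) : p.1 ∈ domG Γ :=
  List.mem_map_of_mem h

theorem mem_domG_eraseG {Γ : List (ℕ × β)} {x z : ℕ} :
    z ∈ domG (eraseG Γ x) ↔ z ∈ domG Γ ∧ z ≠ x := by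
  simp only [domG, eraseG, List.mem_map, List.mem_filter]
  constructor
  · rintro ⟨p, ⟨hp, hx⟩, rfl⟩
    exact ⟨⟨p, hp, rfl⟩, by simpa using hx⟩
  · rintro ⟨⟨p, hp, rfl⟩, hx⟩
    exact ⟨p, ⟨hp, by simpa using hx⟩, rfl⟩

theorem consistentG_eraseG {Γ : List (ℕ × β)} (h : consistentG Γ) (x : ℕ) :
    consistentG (eraseG Γ x) :=
  h.sublist (List.filter_sublist.map _)

theorem mem_domG_renG {Γ : List (ℕ × β)} {x y z : ℕ} (hy : y ∉ domG Γ) :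
    z ∈ domG (renG Γ x y) ↔ (z = y ∧ x ∈ domG Γ) ∨ (z ≠ x ∧ z ∈ domG Γ) := by
  induction Γ with
  | nil => simp [domG, renG]
  | cons p Γ ih =>
    simp only [domG_cons, List.mem_cons, not_or] at hy
    have := ih hy.2
    simp only [renG, List.map_cons, domG_cons, List.mem_cons] at this ⊢
    rw [this]
    grind

theorem consistentG_renG {Γ : List (ℕ × β)} {x y : ℕ} (h : consistentG Γ) (hy : y ∉ domG Γ) :
    consistentG (renG Γ x y) := by
  induction Γ with
  | nil => exact List.nodup_nil
  | cons p Γ ih =>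
    simp only [domG_cons, List.mem_cons, not_or] at hy
    have h' : p.1 ∉ domG Γ ∧ consistentG Γ := List.nodup_cons.1 h
    refine List.nodup_cons.2 ⟨fun hm => ?_, ih h'.2 hy.2⟩
    have := (mem_domG_renG (x := x) hy.2).1 hm
    grind

theorem renG_eq_self {Γ : List (ℕ × β)} {x y : ℕ} (hx : x ∉ domG Γ) : renG Γ x y = Γ := by
  unfold renG
  conv_rhs => rw [← List.map_id Γ]
  refine List.map_congr_left fun p hp => ?_
  have : p.1 ≠ x := fun e => hx (e ▸ mem_domG_of_mem hp)
  simp [this]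

theorem renG_eraseG {Γ : List (ℕ × β)} {x y z : ℕ} (hx : z ≠ x) (hy : z ≠ y) :
    renG (eraseG Γ z) x y = eraseG (renG Γ x y) z := by
  simp only [renG, eraseG, List.filter_map]
  congr 1
  refine List.filter_congr fun p _ => ?_
  grind

theorem mem_renG {Γ : List (ℕ × β)} {x y z : ℕ} {b : β} (hx : z ≠ x) (h : (z, b) ∈ Γ) :
    (z, b) ∈ renG Γ x y :=
  List.mem_map.2 ⟨(z, b), h, by simp [hx]⟩

end GEnvLemmas

section Lookup
variable {β : Type} [Zero β]

theorem lookupG_nil (z : ℕ) : lookupG ([] : List (ℕ × β)) z = 0 := rfl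

theorem lookupG_cons (p : ℕ × β) (Γ : List (ℕ × β)) (z : ℕ) :
    lookupG (p :: Γ) z = if p.1 = z then p.2 else lookupG Γ z := by
  by_cases h : p.1 = z <;> simp [lookupG, h]

theorem lookupG_eq_zero {Γ : List (ℕ × β)} {z : ℕ} (h : z ∉ domG Γ) : lookupG Γ z = 0 := by
  induction Γ with
  | nil => rfl
  | cons p Γ ih =>
    simp only [domG_cons, List.mem_cons, not_or] at h
    rw [lookupG_cons, if_neg (Ne.symm h.1), ih h.2]

theorem lookupG_append (Γ Δ : List (ℕ × β)) (z : ℕ) :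
    lookupG (Γ ++ Δ) z = if z ∈ domG Γ then lookupG Γ z else lookupG Δ z := by
  induction Γ with
  | nil => simp [domG]
  | cons p Γ ih =>
    simp only [List.cons_append, lookupG_cons, ih, domG_cons, List.mem_cons]
    grind

theorem mem_iff_lookupG {Γ : List (ℕ × β)} (h : consistentG Γ) (p : ℕ × β) :
    p ∈ Γ ↔ p.1 ∈ domG Γ ∧ lookupG Γ p.1 = p.2 := by
  induction Γ with
  | nil => simp [domG]
  | cons q Γ ih =>
    have h' : q.1 ∉ domG Γ ∧ consistentG Γ := List.nodup_cons.1 h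
    rw [List.mem_cons, ih h'.2, lookupG_cons, domG_cons, List.mem_cons]
    constructor
    · rintro (rfl | ⟨h1, h2⟩)
      · simp
      · have : q.1 ≠ p.1 := fun e => h'.1 (e ▸ h1)
        simp [this, h1, h2]
    · rintro ⟨h1, h2⟩
      by_cases e : q.1 = p.1
      · rw [if_pos e] at h2
        exact Or.inl (Prod.ext e.symm h2.symm)
      · rw [if_neg e] at h2
        exact Or.inr ⟨h1.resolve_left (Ne.symm e), h2⟩

/-- consistent environments with the same domain and the same lookups are permutations of each
other -/
theorem perm_of_lookupG {Γ Δ : List (ℕ × β)} (hΓ : consistentG Γ) (hΔ : consistentG Δ)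
    (hd : ∀ z, z ∈ domG Γ ↔ z ∈ domG Δ) (hl : ∀ z, lookupG Γ z = lookupG Δ z) : Γ.Perm Δ := by
  refine (List.perm_ext_iff_of_nodup (List.Nodup.of_map _ hΓ) (List.Nodup.of_map _ hΔ)).2
    fun p => ?_
  rw [mem_iff_lookupG hΓ, mem_iff_lookupG hΔ, hd, hl]

theorem lookupG_eraseG (Γ : List (ℕ × β)) (x z : ℕ) :
    lookupG (eraseG Γ x) z = if z = x then 0 else lookupG Γ z := by
  induction Γ with
  | nil => simp [eraseG, lookupG_nil]
  | cons p Γ ih =>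
    by_cases hp : p.1 = x
    · have : eraseG (p :: Γ) x = eraseG Γ x := by simp [eraseG, hp]
      rw [this, ih, lookupG_cons]
      grind
    · have : eraseG (p :: Γ) x = p :: eraseG Γ x := by simp [eraseG, hp]
      rw [this, lookupG_cons, ih, lookupG_cons]
      grind

theorem lookupG_renG {Γ : List (ℕ × β)} {x y : ℕ} (hy : y ∉ domG Γ) (z : ℕ) :
    lookupG (renG Γ x y) z =
      if z = y then lookupG Γ x else if z = x then 0 else lookupG Γ z := by
  induction Γ with
  | nil => simp [renG, lookupG_nil]
  | cons p Γ ih =>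
    simp only [domG_cons, List.mem_cons, not_or] at hy
    have := ih hy.2
    simp only [renG, List.map_cons] at this ⊢
    rw [lookupG_cons, this, lookupG_cons, lookupG_cons]
    grind

end Lookup

section Merge
variable {β : Type} [AddMonoid β]

theorem mem_domG_addG {Γ Δ : List (ℕ × β)} {z : ℕ} :
    z ∈ domG (addG Γ Δ) ↔ z ∈ domG Γ ∨ z ∈ domG Δ := by
  simp only [domG, addG, List.map_append, List.mem_append, List.map_map, List.mem_map,
    List.mem_filter, Function.comp_apply]
  constructor
  · rintro (⟨p, hp, rfl⟩ | ⟨p, ⟨hp, -⟩, rfl⟩)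
    exacts [Or.inl ⟨p, hp, rfl⟩, Or.inr ⟨p, hp, rfl⟩]
  · rintro (⟨p, hp, rfl⟩ | ⟨p, hp, rfl⟩)
    · exact Or.inl ⟨p, hp, rfl⟩
    · by_cases h : ∃ q ∈ Γ, q.1 = p.1
      · exact Or.inl h
      · refine Or.inr ⟨p, ⟨hp, ?_⟩, rfl⟩
        simpa using h

theorem consistentG_addG {Γ Δ : List (ℕ × β)} (hΓ : consistentG Γ) (hΔ : consistentG Δ) :
    consistentG (addG Γ Δ) := by
  unfold consistentG addG
  rw [List.map_append, List.nodup_append']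
  refine ⟨?_, hΔ.sublist (List.filter_sublist.map _), ?_⟩
  · rw [List.map_map]
    exact hΓ
  · intro z hz hz'
    simp only [List.map_map, List.mem_map, List.mem_filter, Function.comp_apply] at hz hz'
    obtain ⟨p, hp, rfl⟩ := hz
    obtain ⟨q, ⟨-, hq⟩, e⟩ := hz'
    simp only [List.contains_eq_mem, List.mem_map, Bool.not_eq_eq_eq_not, Bool.not_true,
      decide_eq_false_iff_not] at hq
    exact hq ⟨p, hp, e.symm⟩

theorem lookupG_addG (Γ Δ : List (ℕ × β)) (z : ℕ) :
    lookupG (addG Γ Δ) z = lookupG Γ z + lookupG Δ z := by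
  unfold addG
  rw [lookupG_append]
  have hd : domG (Γ.map fun p => (p.1, p.2 + lookupG Δ p.1)) = domG Γ := by
    simp [domG, Function.comp_def]
  rw [hd]
  split_ifs with hz
  · clear hd
    induction Γ with
    | nil => simp [domG] at hz
    | cons p Γ ih =>
      rw [List.map_cons, lookupG_cons, lookupG_cons]
      by_cases h : p.1 = z
      · simp [h]
      · rw [if_neg h, if_neg h]
        rw [domG_cons, List.mem_cons] at hz
        exact ih (hz.resolve_left (Ne.symm h))
  · rw [lookupG_eq_zero hz, zero_add]
    clear hd
    induction Δ with
    | nil => rfl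
    | cons p Δ ih =>
      rw [List.filter_cons, lookupG_cons]
      by_cases h : p.1 = z
      · have : p.1 ∉ List.map Prod.fst Γ := by rw [h]; exact hz
        rw [if_pos (by simpa using this), lookupG_cons, if_pos h, if_pos h]
      · rw [if_neg h]
        split_ifs
        · rw [lookupG_cons, if_neg h, ih]
        · exact ih

theorem addG_nil (Γ : List (ℕ × β)) : addG Γ [] = Γ := by
  simp [addG, lookupG_nil]

theorem addG_eq_append {Γ Δ : List (ℕ × β)} (h : ∀ z ∈ domG Γ, z ∉ domG Δ) :
    addG Γ Δ = Γ ++ Δ := by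
  unfold addG
  congr 1
  · conv_rhs => rw [← List.map_id Γ]
    refine List.map_congr_left fun p hp => ?_
    rw [lookupG_eq_zero (h _ (mem_domG_of_mem hp)), add_zero]
    rfl
  · refine List.filter_eq_self.2 fun p hp => ?_
    have : p.1 ∉ List.map Prod.fst Γ := fun hm => h _ hm (mem_domG_of_mem hp)
    simpa using this

theorem renG_addG {Γ Δ : List (ℕ × β)} {x y : ℕ} (hΓ : y ∉ domG Γ) (hΔ : y ∉ domG Δ) :
    renG (addG Γ Δ) x y = addG (renG Γ x y) (renG Δ x y) := by
  unfold addG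
  rw [show List.map Prod.fst (renG Γ x y) = domG (renG Γ x y) from rfl]
  unfold renG
  rw [List.map_append, List.map_map, List.map_map, List.filter_map]
  congr 1
  · refine List.map_congr_left fun p hp => ?_
    have hp' : p.1 ≠ y := fun e => hΓ (e ▸ mem_domG_of_mem hp)
    have := lookupG_renG (x := x) hΔ (if p.1 = x then y else p.1)
    simp only [renG] at this
    simp only [Function.comp_apply, this]
    grind
  · congr 1
    refine List.filter_congr fun p hp => ?_
    have hp' : p.1 ≠ y := fun e => hΔ (e ▸ mem_domG_of_mem hp)
    have := mem_domG_renG (x := x) (z := if p.1 = x then y else p.1) hΓ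
    simp only [renG] at this
    simp only [Function.comp_apply, List.contains_eq_mem, this]
    congr 2
    change (p.1 ∈ domG Γ) = _
    grind

theorem mem_domG_sumG {L : List (List (ℕ × β))} {z : ℕ} :
    z ∈ domG (sumG L) ↔ ∃ Γ ∈ L, z ∈ domG Γ := by
  induction L with
  | nil => simp [sumG, domG]
  | cons Γ L ih =>
    change z ∈ domG (addG Γ (sumG L)) ↔ _
    simp [mem_domG_addG, ih]

theorem consistentG_sumG {L : List (List (ℕ × β))} (h : ∀ Γ ∈ L, consistentG Γ) :
    consistentG (sumG L) := by
  induction L with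
  | nil => exact List.nodup_nil
  | cons Γ L ih =>
    exact consistentG_addG (h Γ (by simp)) (ih fun Δ hΔ => h Δ (by simp [hΔ]))

theorem renG_sumG {L : List (List (ℕ × β))} {x y : ℕ} (h : ∀ Γ ∈ L, y ∉ domG Γ) :
    renG (sumG L) x y = sumG (L.map fun Γ => renG Γ x y) := by
  induction L with
  | nil => rfl
  | cons Γ L ih =>
    have hL : ∀ Δ ∈ L, y ∉ domG Δ := fun Δ hΔ => h Δ (by simp [hΔ])
    change renG (addG Γ (sumG L)) x y = addG (renG Γ x y) (sumG (L.map fun Γ => renG Γ x y))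
    rw [renG_addG (h Γ (by simp)), ih hL]
    rw [mem_domG_sumG]
    rintro ⟨Δ, hΔ, hy⟩
    exact hL Δ hΔ hy

end Merge

/-! ## Type substitutions on environments -/

theorem domG_envApplyS (S : TSub) (Γ : Env) : domG (envApplyS S Γ) = domG Γ := by
  simp [domG, envApplyS, Function.comp_def]

theorem consistentG_envApplyS {Γ : Env} (S : TSub) (h : consistentG Γ) :
    consistentG (envApplyS S Γ) := by
  change (domG (envApplyS S Γ)).Nodup
  rw [domG_envApplyS]
  exact h

theorem envApplyS_append (S : TSub) (Γ Δ : Env) :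
    envApplyS S (Γ ++ Δ) = envApplyS S Γ ++ envApplyS S Δ :=
  List.map_append

theorem envApplyS_cons (S : TSub) (x : ℕ) (A : Multiset LTy) (Γ : Env) :
    envApplyS S ((x, A) :: Γ) = (x, A.map (LTy.applyS S)) :: envApplyS S Γ :=
  rfl

theorem envApplyS_nil (S : TSub) : envApplyS S [] = [] := rfl

theorem renG_envApplyS (S : TSub) (Γ : Env) (x y : ℕ) :
    renG (envApplyS S Γ) x y = envApplyS S (renG Γ x y) := by
  simp [renG, envApplyS, Function.comp_def]

theorem lookupG_envApplyS (S : TSub) (Γ : Env) (z : ℕ) :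
    lookupG (envApplyS S Γ) z = (lookupG Γ z).map (LTy.applyS S) := by
  induction Γ with
  | nil => rfl
  | cons p Γ ih =>
    rw [show p = (p.1, p.2) from rfl, envApplyS_cons, lookupG_cons, lookupG_cons, ih]
    split_ifs <;> rfl

theorem envApplyS_addG (S : TSub) (Γ Δ : Env) :
    envApplyS S (addG Γ Δ) = addG (envApplyS S Γ) (envApplyS S Δ) := by
  have hd : List.map Prod.fst (envApplyS S Γ) = List.map Prod.fst Γ := domG_envApplyS S Γ
  unfold addG
  rw [hd]
  simp only [lookupG_envApplyS]
  simp [envApplyS, List.filter_map, Function.comp_def]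

theorem envApplyS_sumG (S : TSub) (L : List Env) :
    envApplyS S (sumG L) = sumG (L.map (envApplyS S)) := by
  induction L with
  | nil => rfl
  | cons Γ L ih =>
    change envApplyS S (addG Γ (sumG L)) = addG (envApplyS S Γ) (sumG (L.map (envApplyS S)))
    rw [envApplyS_addG, ih]

theorem Ty2.applyS_mkLolly (S : TSub) (τ : LTy) (σ : Ty2) :
    (Ty2.mkLolly τ σ).applyS S = Ty2.mkLolly (τ.applyS S) (σ.applyS S) := by
  cases σ <;> rfl

theorem envTv_renG (Γ : Env) (x y : ℕ) : envTv (renG Γ x y) = envTv Γ := by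
  simp [envTv, renG, List.foldr_map]

theorem tvOf_renG (Γ : Env) (x y : ℕ) (σ : Ty2) : tvOf (renG Γ x y) σ = tvOf Γ σ := by
  simp [tvOf, envTv_renG]

/-! ## Renaming of term variables -/

namespace Term

/-- the number of constructors of a term -/
def size : Term → ℕ
  | .var _ => 1
  | .lam _ M => size M + 1
  | .app M N => size M + size N + 1

theorem size_subst_var (M : Term) (x y : ℕ) : (M.subst x (.var y)).size = M.size := by
  induction M with
  | var z => simp only [subst]; split_ifs <;> rfl
  | lam z M ih => simp only [subst]; split_ifs <;> simp [size, ih]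
  | app M N ihM ihN => simp [subst, size, ihM, ihN]

theorem subst_self (M : Term) (x : ℕ) : M.subst x (.var x) = M := by
  induction M with
  | var z => simp only [subst]; split_ifs with h <;> simp [h]
  | lam z M ih => simp only [subst]; split_ifs <;> simp [ih]
  | app M N ihM ihN => simp [subst, ihM, ihN]

theorem subst_eq_self {M : Term} {x : ℕ} (h : x ∉ M.allVars) (N : Term) : M.subst x N = M := by
  induction M with
  | var z =>
    have : z ≠ x := fun e => h (by simp [allVars, e])
    simp [subst, this]
  | lam z M ih =>
    simp only [allVars, Finset.mem_insert, not_or] at h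
    simp [subst, ih h.2]
  | app M N ihM ihN =>
    simp only [allVars, Finset.mem_union, not_or] at h
    simp [subst, ihM h.1, ihN h.2]

theorem subst_subst_var {M : Term} {x y : ℕ} (h : y ∉ M.allVars) :
    (M.subst x (.var y)).subst y (.var x) = M := by
  induction M with
  | var z =>
    have : z ≠ y := fun e => h (by simp [allVars, e])
    by_cases hz : z = x <;> simp [subst, hz, this]
  | lam z M ih =>
    simp only [allVars, Finset.mem_insert, not_or] at h
    by_cases hz : z = x
    · simp only [subst, if_pos hz, if_neg (Ne.symm h.1), subst_eq_self h.2]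
    · simp only [subst, if_neg hz, if_neg (Ne.symm h.1), ih h.2]
  | app M N ihM ihN =>
    simp only [allVars, Finset.mem_union, not_or] at h
    simp [subst, ihM h.1, ihN h.2]

end Term

/-! ## Invariants of the inference algorithm -/

theorem Infer.consistentG {M : Term} {Γ : Env} {σ : Ty2} (h : Infer M Γ σ) : consistentG Γ := by
  induction h with
  | var x α => exact List.nodup_singleton x
  | lamLolly x τ _ _ ih => exact consistentG_eraseG ih x
  | lamArrow x A _ _ _ ih => exact consistentG_eraseG ih x
  | appVar α₁ τ₂ α₂ α₃ S _ _ _ _ _ _ _ ih₁ ih₂ =>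
    exact consistentG_envApplyS S (consistentG_addG ih₁ ih₂)
  | appArrow l ts S _ _ _ _ _ _ _ ih₁ ih₂ =>
    refine consistentG_envApplyS S (consistentG_addG ih₁ (consistentG_sumG ?_))
    simp only [List.mem_map]
    rintro _ ⟨p, hp, rfl⟩
    exact ih₂ p hp
  | appLolly τ σ₁ τ₂ S _ _ _ _ ih₁ ih₂ =>
    exact consistentG_envApplyS S (consistentG_addG ih₁ ih₂)

theorem Infer.domG_subset {M : Term} {Γ : Env} {σ : Ty2} (h : Infer M Γ σ) :
    ∀ z ∈ domG Γ, z ∈ M.allVars := by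
  induction h with
  | var x α => simp [domG, Term.allVars]
  | lamLolly x τ _ _ ih =>
    intro z hz
    exact Finset.mem_insert_of_mem (ih z (mem_domG_eraseG.1 hz).1)
  | lamArrow x A _ _ _ ih =>
    intro z hz
    exact Finset.mem_insert_of_mem (ih z (mem_domG_eraseG.1 hz).1)
  | appVar α₁ τ₂ α₂ α₃ S _ _ _ _ _ _ _ ih₁ ih₂ =>
    intro z hz
    rw [domG_envApplyS, mem_domG_addG] at hz
    exact Finset.mem_union.2 (hz.imp (ih₁ z) (ih₂ z))
  | appArrow l ts S _ _ _ _ _ _ _ ih₁ ih₂ =>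
    intro z hz
    rw [domG_envApplyS, mem_domG_addG, mem_domG_sumG] at hz
    refine Finset.mem_union.2 (hz.imp (ih₁ z) ?_)
    simp only [List.mem_map]
    rintro ⟨_, ⟨p, hp, rfl⟩, hz⟩
    exact ih₂ p hp z hz
  | appLolly τ σ₁ τ₂ S _ _ _ _ ih₁ ih₂ =>
    intro z hz
    rw [domG_envApplyS, mem_domG_addG] at hz
    exact Finset.mem_union.2 (hz.imp (ih₁ z) (ih₂ z))

/-- inference is equivariant under renaming a variable to a fresh one -/
theorem Infer.rename {M : Term} {Γ : Env} {σ : Ty2} (h : Infer M Γ σ) {x y : ℕ}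
    (hy : y ∉ M.allVars) : Infer (M.subst x (.var y)) (renG Γ x y) σ := by
  induction h with
  | var z α =>
    by_cases hz : z = x
    · simpa [Term.subst, renG, hz] using Infer.var y α
    · simpa [Term.subst, renG, hz] using Infer.var z α
  | lamLolly z τ h₁ hm ih =>
    simp only [Term.allVars, Finset.mem_insert, not_or] at hy
    by_cases hz : z = x
    · rw [Term.subst, if_pos hz, renG_eq_self (by simp [mem_domG_eraseG, hz])]
      exact .lamLolly z τ h₁ hm
    · rw [Term.subst, if_neg hz, renG_eraseG hz (Ne.symm hy.1)]
      exact .lamLolly z τ (ih hy.2) (mem_renG hz hm)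
  | lamArrow z A h₁ hm hA ih =>
    simp only [Term.allVars, Finset.mem_insert, not_or] at hy
    by_cases hz : z = x
    · rw [Term.subst, if_pos hz, renG_eq_self (by simp [mem_domG_eraseG, hz])]
      exact .lamArrow z A h₁ hm hA
    · rw [Term.subst, if_neg hz, renG_eraseG hz (Ne.symm hy.1)]
      exact .lamArrow z A (ih hy.2) (mem_renG hz hm) hA
  | appVar α₁ τ₂ α₂ α₃ S h₁ h₂ hd hα₂ hα₃ hne hS ih₁ ih₂ =>
    simp only [Term.allVars, Finset.mem_union, not_or] at hy
    rw [Term.subst, renG_envApplyS, renG_addG (fun hm => hy.1 (h₁.domG_subset y hm))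
      (fun hm => hy.2 (h₂.domG_subset y hm))]
    exact .appVar α₁ τ₂ α₂ α₃ S (ih₁ hy.1) (ih₂ hy.2) (by simpa only [tvOf_renG] using hd)
      (by simpa only [tvOf_renG] using hα₂) (by simpa only [tvOf_renG] using hα₃) hne hS
  | @appArrow M₁ M₂ Γ₁ σ₁ l ts S h₁ h₂ hlen h2 hpw hd hS ih₁ ih₂ =>
    simp only [Term.allVars, Finset.mem_union, not_or] at hy
    have hl : ∀ Γ ∈ l.map Prod.fst, y ∉ domG Γ := by
      simp only [List.mem_map]
      rintro _ ⟨p, hp, rfl⟩ hm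
      exact hy.2 ((h₂ p hp).domG_subset y hm)
    rw [Term.subst, renG_envApplyS, renG_addG (fun hm => hy.1 (h₁.domG_subset y hm))
      (fun hm => by
        obtain ⟨Γ, hΓ, hm⟩ := mem_domG_sumG.1 hm
        exact hl Γ hΓ hm), renG_sumG hl]
    have := Infer.appArrow (l.map fun p => (renG p.1 x y, p.2)) ts S (ih₁ hy.1)
      (M₂ := M₂.subst x (.var y))
      (by
        simp only [List.mem_map]
        rintro _ ⟨p, hp, rfl⟩
        exact ih₂ p hp hy.2)
      (by simpa using hlen) (by simpa using h2)
      (by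
        rw [List.pairwise_map]
        simpa only [tvOf_renG] using hpw)
      (by
        simp only [List.mem_map]
        rintro _ ⟨p, hp, rfl⟩
        simpa only [tvOf_renG] using hd p hp)
      (by simpa [Function.comp_def] using hS)
    simpa [Function.comp_def] using this
  | appLolly τ σ₁ τ₂ S h₁ h₂ hd hS ih₁ ih₂ =>
    simp only [Term.allVars, Finset.mem_union, not_or] at hy
    rw [Term.subst, renG_envApplyS, renG_addG (fun hm => hy.1 (h₁.domG_subset y hm))
      (fun hm => hy.2 (h₂.domG_subset y hm))]
    exact .appLolly τ σ₁ τ₂ S (ih₁ hy.1) (ih₂ hy.2) (by simpa only [tvOf_renG] using hd) hS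

/-! ## Admissible rules of the type system -/

theorem DerN.applyS {d : ℕ} {Γ : Env} {M : Term} {σ : Ty2} (S : TSub) (h : DerN d Γ M σ) :
    DerN d (envApplyS S Γ) M (σ.applyS S) := by
  induction h with
  | ax x τ => exact .ax x (τ.applyS S)
  | exch d Γ₁ Γ₂ x y A B M σ _ ih =>
    simp only [envApplyS_append, envApplyS_cons] at ih ⊢
    exact .exch _ _ _ _ _ _ _ _ _ ih
  | contr d Γ₁ Γ₂ x₁ x₂ x A B M σ _ hx ih =>
    simp only [envApplyS_append, envApplyS_cons, Multiset.map_add] at ih ⊢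
    refine .contr _ _ _ _ _ _ _ _ _ _ ih ?_
    rwa [← envApplyS_append, domG_envApplyS]
  | introArrow d Γ x A M σ _ hA ih =>
    simp only [envApplyS_append, envApplyS_cons, envApplyS_nil] at ih
    exact .introArrow _ _ _ _ _ _ ih (by simpa using hA)
  | introLolly d Γ x τ M σ _ ih =>
    simp only [envApplyS_append, envApplyS_cons, envApplyS_nil, Multiset.map_singleton] at ih
    rw [Ty2.applyS_mkLolly]
    exact .introLolly _ _ _ _ _ _ ih
  | elimLolly d₁ d₂ Γ₁ Γ₂ M₁ M₂ τ σ _ _ hc ih₁ ih₂ =>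
    rw [Ty2.applyS_mkLolly] at ih₁
    have hc' := consistentG_envApplyS S hc
    rw [envApplyS_append] at hc' ⊢
    exact .elimLolly _ _ _ _ _ _ _ _ ih₁ ih₂ hc'
  | elimArrow d Γ M₁ M₂ σ l _ _ h2 hc ih₁ ih₂ =>
    have hc' := consistentG_envApplyS S hc
    rw [envApplyS_append, envApplyS_sumG] at hc' ⊢
    have := DerN.elimArrow d (envApplyS S Γ) M₁ M₂ (σ.applyS S)
      (l.map fun p => (p.1, envApplyS S p.2.1, p.2.2.applyS S))
      (by simpa [Ty2.applyS, Function.comp_def] using ih₁)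
      (by
        simp only [List.mem_map]
        rintro _ ⟨p, hp, rfl⟩
        exact ih₂ p hp)
      (by simpa using h2)
      (by simpa [Function.comp_def] using hc')
    simpa [Function.comp_def] using this

theorem Der.applyS {Γ : Env} {M : Term} {σ : Ty2} (S : TSub) (h : Der Γ M σ) :
    Der (envApplyS S Γ) M (σ.applyS S) :=
  h.imp fun _ hd => hd.applyS S

theorem Der.perm {Γ Δ : Env} {M : Term} {σ : Ty2} (h : Der Γ M σ) (hp : Γ.Perm Δ) :
    Der Δ M σ := by
  suffices ∀ Θ : Env, Der (Θ ++ Γ) M σ → Der (Θ ++ Δ) M σ from this [] h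
  clear h
  induction hp with
  | nil => exact fun _ h => h
  | cons p _ ih =>
    intro Θ h
    have := ih (Θ ++ [p]) (by simpa using h)
    simpa using this
  | swap p q Γ =>
    rintro Θ ⟨d, h⟩
    exact ⟨d + 1, .exch d Θ Γ q.1 p.1 q.2 p.2 M σ h⟩
  | trans _ _ ih₁ ih₂ => exact fun Θ h => ih₂ Θ (ih₁ Θ h)

theorem Der.elimArrow {Γ : Env} {M₁ M₂ : Term} {σ : Ty2} (l : List (Env × LTy))
    (h₁ : Der Γ M₁ (.arrow (Multiset.ofList (l.map Prod.snd)) σ))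
    (h₂ : ∀ p ∈ l, Der p.1 M₂ (.lin p.2)) (hl : 2 ≤ l.length)
    (hc : consistentG (Γ ++ sumG (l.map Prod.fst))) :
    Der (Γ ++ sumG (l.map Prod.fst)) (.app M₁ M₂) σ := by
  obtain ⟨d, h₁⟩ := h₁
  choose! e he using h₂
  have hsnd : (l.map fun p => (e p, p)).map (fun p => p.2.2) = l.map Prod.snd := by
    simp [Function.comp_def]
  have hfst : (l.map fun p => (e p, p)).map (fun p => p.2.1) = l.map Prod.fst := by
    simp [Function.comp_def]
  have := DerN.elimArrow d Γ M₁ M₂ σ (l.map fun p => (e p, p)) (by rwa [hsnd])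
    (by
      simp only [List.mem_map]
      rintro _ ⟨p, hp, rfl⟩
      exact he p hp)
    (by simpa using hl) (by rwa [hfst])
  rw [hfst] at this
  exact ⟨_, this⟩

/-- contracting a fresh copy `y` of the shared variable `x` -/
theorem Der.contract_addG {Γ Δ : Env} {M : Term} {σ : Ty2} {x y : ℕ}
    (hΓ : consistentG Γ) (hΔ : consistentG Δ) (hxΓ : x ∈ domG Γ) (hxΔ : x ∈ domG Δ)
    (hyΓ : y ∉ domG Γ) (hyΔ : y ∉ domG Δ) (h : Der (addG Γ (renG Δ x y)) M σ) :
    Der (addG Γ Δ) (M.subst y (.var x)) σ := by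
  have hxy : x ≠ y := fun e => hyΓ (e ▸ hxΓ)
  have hc := consistentG_eraseG (consistentG_addG hΓ hΔ) x
  have hxE : x ∉ domG (eraseG (addG Γ Δ) x) := by simp [mem_domG_eraseG]
  have hyE : y ∉ domG (eraseG (addG Γ Δ) x) := by simp [mem_domG_eraseG, mem_domG_addG, hyΓ, hyΔ]
  have hp : (addG Γ (renG Δ x y)).Perm
      ([] ++ (x, lookupG Γ x) :: (y, lookupG Δ x) :: eraseG (addG Γ Δ) x) := by
    refine perm_of_lookupG (consistentG_addG hΓ (consistentG_renG hΔ hyΔ)) ?_ ?_ ?_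
    · exact List.nodup_cons.2 ⟨by
        change x ∉ y :: domG _
        simp [hxy, hxE], List.nodup_cons.2 ⟨hyE, hc⟩⟩
    · intro z
      simp only [List.nil_append, domG_cons, List.mem_cons, mem_domG_addG, mem_domG_renG hyΔ,
        mem_domG_eraseG]
      grind
    · intro z
      have h0 := lookupG_eq_zero hyΓ
      simp only [List.nil_append, lookupG_cons, lookupG_addG, lookupG_renG hyΔ, lookupG_eraseG]
      by_cases h1 : z = x
      · simp [h1, hxy]
      · by_cases h2 : z = y
        · simp [h2, hxy, h0]
        · simp [h1, h2, Ne.symm h1, Ne.symm h2]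
  obtain ⟨d, hd⟩ := h.perm hp
  have hcontr : Der _ _ _ := ⟨_, DerN.contr _ _ _ _ _ x _ _ _ _ hd (by simpa using hxE)⟩
  rw [Term.subst_self] at hcontr
  refine hcontr.perm (perm_of_lookupG ?_ (consistentG_addG hΓ hΔ) ?_ ?_)
  · exact List.nodup_cons.2 ⟨hxE, hc⟩
  · intro z
    simp only [List.nil_append, domG_cons, List.mem_cons, mem_domG_addG, mem_domG_eraseG]
    grind
  · intro z
    simp only [List.nil_append, lookupG_cons, lookupG_addG, lookupG_eraseG]
    by_cases h1 : z = x
    · simp [h1]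
    · simp [h1, Ne.symm h1]

/-- An application can be typed in a merged environment as soon as every renaming of its argument
apart from the function can be typed: the variables in `xs`, which include all shared ones, are
renamed apart in the argument and then contracted. -/
theorem Der.app_of_renamed {Γ₁ : Env} {M₁ : Term} {σ : Ty2} (S : TSub) (hΓ₁ : consistentG Γ₁)
    (xs : List ℕ) (M₂ : Term) (l : List (Env × LTy))
    (hl : ∀ p ∈ l, Infer M₂ p.1 (.lin p.2))
    (hxs : ∀ z ∈ domG Γ₁, z ∈ domG (sumG (l.map Prod.fst)) → z ∈ xs)
    (happ : ∀ (N : Term) (k : List (Env × LTy)), N.size = M₂.size →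
      k.map Prod.snd = l.map Prod.snd → (∀ p ∈ k, Infer N p.1 (.lin p.2)) →
      (∀ z ∈ domG Γ₁, z ∉ domG (envApplyS S (sumG (k.map Prod.fst)))) →
      Der (Γ₁ ++ envApplyS S (sumG (k.map Prod.fst))) (.app M₁ N) σ) :
    Der (addG Γ₁ (envApplyS S (sumG (l.map Prod.fst)))) (.app M₁ M₂) σ := by
  induction xs generalizing M₂ l with
  | nil =>
    have hd : ∀ z ∈ domG Γ₁, z ∉ domG (envApplyS S (sumG (l.map Prod.fst))) := by
      intro z hz hz'
      rw [domG_envApplyS] at hz'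
      simpa using hxs z hz hz'
    rw [addG_eq_append hd]
    exact happ M₂ l rfl rfl hl hd
  | cons x xs ih =>
    by_cases hx : x ∈ domG Γ₁ ∧ x ∈ domG (sumG (l.map Prod.fst))
    · obtain ⟨y, hy⟩ := Infinite.exists_notMem_finset
        (M₁.allVars ∪ M₂.allVars ∪ (domG Γ₁).toFinset)
      simp only [Finset.mem_union, List.mem_toFinset, not_or] at hy
      obtain ⟨⟨hy₁, hy₂⟩, hyΓ⟩ := hy
      have hyl : ∀ Γ ∈ l.map Prod.fst, y ∉ domG Γ := by
        simp only [List.mem_map]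
        rintro _ ⟨p, hp, rfl⟩ hm
        exact hy₂ ((hl p hp).domG_subset y hm)
      have hyΔ : y ∉ domG (sumG (l.map Prod.fst)) := fun hm => by
        obtain ⟨Γ, hΓ, hm⟩ := mem_domG_sumG.1 hm
        exact hyl Γ hΓ hm
      have hcΔ : consistentG (sumG (l.map Prod.fst)) := by
        refine consistentG_sumG ?_
        simp only [List.mem_map]
        rintro _ ⟨p, hp, rfl⟩
        exact (hl p hp).consistentG
      have hren : sumG ((l.map fun p => (renG p.1 x y, p.2)).map Prod.fst) =
          renG (sumG (l.map Prod.fst)) x y := by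
        rw [renG_sumG hyl]
        simp [Function.comp_def]
      have key := ih (M₂.subst x (.var y)) (l.map fun p => (renG p.1 x y, p.2))
        (by
          simp only [List.mem_map]
          rintro _ ⟨p, hp, rfl⟩
          exact (hl p hp).rename hy₂)
        (by
          intro z hz hz'
          rw [hren, mem_domG_renG hyΔ] at hz'
          rcases hz' with ⟨rfl, -⟩ | ⟨hzx, hz'⟩
          · exact absurd hz hyΓ
          · exact (List.mem_cons.1 (hxs z hz hz')).resolve_left hzx)
        (by
          intro N k hN hk
          refine happ N k (hN.trans (Term.size_subst_var _ _ _)) (hk.trans ?_)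
          simp [Function.comp_def])
      rw [hren, ← renG_envApplyS] at key
      have := key.contract_addG hΓ₁ (consistentG_envApplyS S hcΔ) hx.1
        (by rw [domG_envApplyS]; exact hx.2) hyΓ (by rw [domG_envApplyS]; exact hyΔ)
      rwa [Term.subst, Term.subst_eq_self hy₁, Term.subst_subst_var hy₂] at this
    · refine ih M₂ l hl (fun z hz hz' => ?_) happ
      refine (List.mem_cons.1 (hxs z hz hz')).resolve_left ?_
      rintro rfl
      exact hx ⟨hz, hz'⟩

theorem consistentG_append {Γ Δ : Env} (hΓ : consistentG Γ) (hΔ : consistentG Δ)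
    (h : ∀ z ∈ domG Γ, z ∉ domG Δ) : consistentG (Γ ++ Δ) := by
  rw [← addG_eq_append h]
  exact consistentG_addG hΓ hΔ

theorem perm_eraseG_append {Γ : Env} (hΓ : consistentG Γ) {x : ℕ} {A : Multiset LTy}
    (h : (x, A) ∈ Γ) : Γ.Perm (eraseG Γ x ++ [(x, A)]) := by
  have hm := (mem_iff_lookupG hΓ (x, A)).1 h
  refine (perm_of_lookupG hΓ (Δ := (x, A) :: eraseG Γ x) ?_ ?_ ?_).trans
    (List.perm_append_singleton _ _).symm
  · exact List.nodup_cons.2 ⟨fun hx => (mem_domG_eraseG.1 hx).2 rfl, consistentG_eraseG hΓ x⟩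
  · intro z
    rw [domG_cons, List.mem_cons, mem_domG_eraseG]
    grind
  · intro z
    rw [lookupG_cons, lookupG_eraseG]
    grind

/-- soundness of an application whose argument is typed once -/
theorem Der.app_lolly {Γ₁ Γ₂ : Env} {M₁ M₂ : Term} {τ τ₂ : LTy} {σ : Ty2} (S : TSub)
    (hΓ₁ : consistentG Γ₁) (h₁ : Der (envApplyS S Γ₁) M₁ (Ty2.mkLolly τ σ))
    (h₂ : Infer M₂ Γ₂ (.lin τ₂)) (hτ : τ₂.applyS S = τ)
    (ih : ∀ (N : Term) (Δ : Env) (ρ : Ty2), N.size = M₂.size → Infer N Δ ρ → Der Δ N ρ) :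
    Der (envApplyS S (addG Γ₁ Γ₂)) (.app M₁ M₂) σ := by
  have hc₁ := consistentG_envApplyS S hΓ₁
  have := Der.app_of_renamed (M₁ := M₁) (σ := σ) S hc₁ (domG (envApplyS S Γ₁)) M₂ [(Γ₂, τ₂)]
    (by simpa using h₂) (fun z hz _ => hz) (by
      intro N k hN hk hkN hd
      obtain ⟨⟨Δ, τ'⟩, rfl⟩ : ∃ p, k = [p] := by
        rw [← List.length_eq_one_iff]
        simpa using congrArg List.length hk
      obtain rfl : τ' = τ₂ := by simpa using hk
      have hN' : Infer N Δ (.lin τ') := hkN (Δ, τ') (by simp)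
      have hsum : sumG ([(Δ, τ')].map Prod.fst) = Δ := addG_nil Δ
      rw [hsum] at hd ⊢
      obtain ⟨d₁, h₁⟩ := h₁
      obtain ⟨d₂, h₂⟩ := (ih N Δ _ hN hN').applyS S
      subst hτ
      exact ⟨_, .elimLolly d₁ d₂ _ _ M₁ N _ σ h₁ h₂
        (consistentG_append hc₁ (consistentG_envApplyS S hN'.consistentG) hd)⟩)
  rw [envApplyS_addG]
  have hsum : sumG ([(Γ₂, τ₂)].map Prod.fst) = Γ₂ := addG_nil Γ₂
  rwa [hsum] at this

/-- soundness of an application whose argument is typed at least twice -/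
theorem Der.app_arrow {Γ₁ : Env} {M₁ M₂ : Term} {σ : Ty2} (S : TSub) (l : List (Env × LTy))
    (hΓ₁ : consistentG Γ₁)
    (h₁ : Der (envApplyS S Γ₁) M₁
      (.arrow (Multiset.ofList ((l.map Prod.snd).map (LTy.applyS S))) σ))
    (h₂ : ∀ p ∈ l, Infer M₂ p.1 (.lin p.2)) (hl : 2 ≤ l.length)
    (ih : ∀ (N : Term) (Δ : Env) (ρ : Ty2), N.size = M₂.size → Infer N Δ ρ → Der Δ N ρ) :
    Der (envApplyS S (addG Γ₁ (sumG (l.map Prod.fst)))) (.app M₁ M₂) σ := by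
  have hc₁ := consistentG_envApplyS S hΓ₁
  rw [envApplyS_addG]
  refine Der.app_of_renamed S hc₁ (domG (envApplyS S Γ₁)) M₂ l h₂ (fun z hz _ => hz) ?_
  intro N k hN hk hkN hd
  have hck : consistentG (envApplyS S (sumG (k.map Prod.fst))) := by
    refine consistentG_envApplyS S (consistentG_sumG ?_)
    simp only [List.mem_map]
    rintro _ ⟨p, hp, rfl⟩
    exact (hkN p hp).consistentG
  have hlen : k.length = l.length := by simpa using congrArg List.length hk
  have hc := consistentG_append hc₁ hck hd
  have hfst : envApplyS S (sumG (k.map Prod.fst)) =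
      sumG ((k.map fun p => (envApplyS S p.1, p.2.applyS S)).map Prod.fst) := by
    rw [envApplyS_sumG]
    simp [Function.comp_def]
  rw [hfst] at hc ⊢
  refine Der.elimArrow _ ?_ ?_ (by simpa [hlen] using hl) hc
  · rw [← hk] at h₁
    simpa [Function.comp_def] using h₁
  · simp only [List.mem_map]
    rintro _ ⟨p, hp, rfl⟩
    exact (ih N p.1 _ hN (hkN p hp)).applyS S

theorem map_applyS_eq_of_unifies {S : TSub} :
    ∀ {l k : List LTy}, l.length = k.length → Unifies S (l.zip k) →
      l.map (LTy.applyS S) = k.map (LTy.applyS S)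
  | [], [], _, _ => rfl
  | a :: l, b :: k, hlen, h => by
    rw [List.map_cons, List.map_cons, h (a, b) (by simp),
      map_applyS_eq_of_unifies (by simpa using hlen) fun e he => h e (by simp [he])]

theorem Infer.der_of_size (n : ℕ) : ∀ (M : Term) (Γ : Env) (σ : Ty2), M.size = n →
    Infer M Γ σ → Der Γ M σ := by
  induction n using Nat.strong_induction_on with
  | _ n ih =>
    intro M Γ σ hn h
    have ih' : ∀ (M' N : Term) (Δ : Env) (ρ : Ty2), M'.size < M.size → N.size = M'.size →
        Infer N Δ ρ → Der Δ N ρ :=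
      fun M' N Δ ρ hlt hN hi => ih N.size (by omega) N Δ ρ rfl hi
    cases h with
    | var x α => exact ⟨0, .ax x (.var α)⟩
    | @lamLolly M₁ Γ₁ σ₁ x τ h₁ hm =>
      obtain ⟨d, hd⟩ := (ih' M₁ M₁ _ _ (by simp [Term.size]) rfl h₁).perm
        (perm_eraseG_append h₁.consistentG hm)
      exact ⟨_, .introLolly d _ x τ M₁ σ₁ hd⟩
    | @lamArrow M₁ Γ₁ σ₁ x A h₁ hm hA =>
      obtain ⟨d, hd⟩ := (ih' M₁ M₁ _ _ (by simp [Term.size]) rfl h₁).perm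
        (perm_eraseG_append h₁.consistentG hm)
      exact ⟨_, .introArrow d _ x A M₁ σ₁ hd hA⟩
    | @appVar M₁ M₂ Γ₁ Γ₂ α₁ τ₂ α₂ α₃ S h₁ h₂ _ _ _ _ hS =>
      have hd₁ := (ih' M₁ M₁ _ _ (by simp only [Term.size]; omega) rfl h₁).applyS S
      have e₁ : S α₁ = .lolly (S α₂) (S α₃) :=
        hS.1 (LTy.var α₁, LTy.lolly (.var α₂) (.var α₃)) (by simp)
      have e₂ : τ₂.applyS S = S α₂ := hS.1 (τ₂, LTy.var α₂) (by simp)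
      simp only [Ty2.applyS, LTy.applyS, e₁] at hd₁
      exact Der.app_lolly S h₁.consistentG hd₁ h₂ e₂
        fun N Δ ρ => ih' M₂ N Δ ρ (by simp only [Term.size]; omega)
    | @appArrow M₁ M₂ Γ₁ σ₁ l ts S h₁ h₂ hlen h2 _ _ hS =>
      have hd₁ := (ih' M₁ M₁ _ _ (by simp only [Term.size]; omega) rfl h₁).applyS S
      simp only [Ty2.applyS, Multiset.map_coe] at hd₁
      rw [← map_applyS_eq_of_unifies (by simpa using hlen) hS.1] at hd₁
      exact Der.app_arrow S l h₁.consistentG hd₁ h₂ h2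
        fun N Δ ρ => ih' M₂ N Δ ρ (by simp only [Term.size]; omega)
    | @appLolly M₁ M₂ Γ₁ Γ₂ τ σ₁ τ₂ S h₁ h₂ _ hS =>
      have hd₁ := (ih' M₁ M₁ _ _ (by simp only [Term.size]; omega) rfl h₁).applyS S
      rw [Ty2.applyS_mkLolly] at hd₁
      exact Der.app_lolly S h₁.consistentG hd₁ h₂ (hS.1 (τ₂, τ) (by simp))
        fun N Δ ρ => ih' M₂ N Δ ρ (by simp only [Term.size]; omega)

/-- **Soundness of type inference.** If the type inference algorithm succeeds
with `T(M) = (Γ, σ)`, then `Γ ⊢₂ M : σ` is derivable in the Linear Rank 2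
Intersection Type System. -/
theorem infer_sound (M : Term) (Γ : Env) (σ : Ty2)
    (h : Infer M Γ σ) :
    Der Γ M σ := by
  exact Infer.der_of_size M.size M Γ σ rfl h
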